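/- Every locally compact separable metric space has a strongly proper dyadic subbase. -/

import Mathlib

open TopologicalSpace

/-- The boundary set `S_k^∂ = X \ (S_k^0 ∪ S_k^1)`. -/
def dyadicBd {X : Type*} (S : ℕ → Bool → Set X) (k : ℕ) : Set X :=
  (S k false ∪ S k true)ᶜ

/-- `S(σ)` for a finite partial function `σ` from ℕ to `{0,1,∂}`, encoded by a finite
domain `dom` and values `σ : ℕ → Option Bool` (`some a` means the digit `a`, `none` means `∂`). -/
def dyadicOpen3 {X : Type*} (S : ℕ → Bool → Set X) (dom : Finset ℕ)
    (σ : ℕ → Option Bool) : Set X :=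
  ⋂ k ∈ dom, (σ k).elim (dyadicBd S k) (S k)

/-- `S̄(σ)` for a finite partial function `σ` from ℕ to `{0,1,∂}`. -/
def dyadicClosed3 {X : Type*} (S : ℕ → Bool → Set X) (dom : Finset ℕ)
    (σ : ℕ → Option Bool) : Set X :=
  ⋂ k ∈ dom, (σ k).elim (dyadicBd S k) (fun a => S k a ∪ dyadicBd S k)

section

open Set Topology

/-- The signed gap from the threshold `t` to the value `y`, positive exactly when `y` lies on
side `a` of `t` (`true` is above, `false` is below). -/
def sideGap (a : Bool) (y t : ℝ) : ℝ := if a then y - t else t - y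

/-- The dyadic family cut out by the functions `f n` at the thresholds `c n`. -/
def thresholdFamily {X : Type*} (f : ℕ → X → ℝ) (c : ℕ → Ioo (0 : ℝ) 1) (n : ℕ) (a : Bool) :
    Set X :=
  {x | 0 < sideGap a (f n x) (c n)}

/-- The closed condition attached to a digit: `f n = c n` for `∂`, a weak inequality otherwise. -/
def weakCell {X : Type*} (f : ℕ → X → ℝ) (c : ℕ → Ioo (0 : ℝ) 1) (p : ℕ × Option Bool) : Set X :=
  {x | p.2.elim (f p.1 x = c p.1) fun a => 0 ≤ sideGap a (f p.1 x) (c p.1)}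

/-- The thresholds for which some point of `K` satisfies all the closed conditions in `F`. -/
def feasibleThresholds {X : Type*} (f : ℕ → X → ℝ) (K : Set X) (F : Finset (ℕ × Option Bool)) :
    Set (ℕ → Ioo (0 : ℝ) 1) :=
  {c | ∃ x ∈ K, ∀ p ∈ F, x ∈ weakCell f c p}

theorem continuous_sideGap {Y : Type*} [TopologicalSpace Y] (a : Bool) {g h : Y → ℝ}
    (hg : Continuous g) (hh : Continuous h) : Continuous fun y => sideGap a (g y) (h y) := by
  cases a
  · exact hh.sub hg
  · exact hg.sub hh

theorem dyadicBd_thresholdFamily {X : Type*} (f : ℕ → X → ℝ) (c : ℕ → Ioo (0 : ℝ) 1) (n : ℕ) :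
    dyadicBd (thresholdFamily f c) n = {x | f n x = c n} := by
  ext x
  simp only [dyadicBd, thresholdFamily, sideGap, mem_compl_iff, mem_union, mem_ofPred_eq, not_or,
    not_lt, Bool.false_eq_true, if_false, if_true, sub_nonpos]
  exact ⟨fun h => le_antisymm h.2 h.1, fun h => ⟨h.ge, h.le⟩⟩

theorem thresholdFamily_union_dyadicBd {X : Type*} (f : ℕ → X → ℝ) (c : ℕ → Ioo (0 : ℝ) 1)
    (n : ℕ) (a : Bool) :
    thresholdFamily f c n a ∪ dyadicBd (thresholdFamily f c) n =
      {x | 0 ≤ sideGap a (f n x) (c n)} := by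
  ext x
  rw [dyadicBd_thresholdFamily]
  cases a
  · simp only [thresholdFamily, sideGap, mem_union, mem_ofPred_eq, Bool.false_eq_true, if_false,
      sub_pos, sub_nonneg]
    exact le_iff_lt_or_eq.symm
  · simp only [thresholdFamily, sideGap, mem_union, mem_ofPred_eq, if_true, sub_pos, sub_nonneg]
    rw [eq_comm]
    exact le_iff_lt_or_eq.symm

theorem mem_dyadicClosed3_thresholdFamily {X : Type*} (f : ℕ → X → ℝ) (c : ℕ → Ioo (0 : ℝ) 1)
    (dom : Finset ℕ) (σ : ℕ → Option Bool) (x : X) :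
    x ∈ dyadicClosed3 (thresholdFamily f c) dom σ ↔ ∀ n ∈ dom, x ∈ weakCell f c (n, σ n) := by
  simp only [dyadicClosed3, mem_iInter₂]
  refine forall₂_congr fun n _ => ?_
  cases σ n
  · simp [weakCell, dyadicBd_thresholdFamily]
  · simp only [Option.elim_some, thresholdFamily_union_dyadicBd, weakCell]

theorem isOpen_thresholdFamily {X : Type*} [TopologicalSpace X] {f : ℕ → X → ℝ}
    (hf : ∀ n, Continuous (f n)) (c : ℕ → Ioo (0 : ℝ) 1) (n : ℕ) (a : Bool) :
    IsOpen (thresholdFamily f c n a) :=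
  isOpen_lt continuous_const (continuous_sideGap a (hf n) continuous_const)

theorem isClosed_dyadicClosed3_thresholdFamily {X : Type*} [TopologicalSpace X] {f : ℕ → X → ℝ}
    (hf : ∀ n, Continuous (f n)) (c : ℕ → Ioo (0 : ℝ) 1) (dom : Finset ℕ) (σ : ℕ → Option Bool) :
    IsClosed (dyadicClosed3 (thresholdFamily f c) dom σ) := by
  refine isClosed_biInter fun n _ => ?_
  cases σ n
  · rw [Option.elim_none, dyadicBd_thresholdFamily]
    exact isClosed_eq (hf n) continuous_const
  · rw [Option.elim_some, thresholdFamily_union_dyadicBd]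
    exact isClosed_le continuous_const (continuous_sideGap _ (hf n) continuous_const)

theorem dyadicOpen3_subset_dyadicClosed3 {X : Type*} (S : ℕ → Bool → Set X) (dom : Finset ℕ)
    (σ : ℕ → Option Bool) : dyadicOpen3 S dom σ ⊆ dyadicClosed3 S dom σ := by
  refine iInter₂_mono fun n _ => ?_
  cases σ n
  · exact Subset.rfl
  · exact subset_union_left

theorem isClosed_feasibleThresholds {X : Type*} [TopologicalSpace X] {f : ℕ → X → ℝ}
    (hf : ∀ n, Continuous (f n)) {K : Set X} (hK : IsCompact K) (F : Finset (ℕ × Option Bool)) :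
    IsClosed (feasibleThresholds f K F) := by
  have : CompactSpace K := isCompact_iff_compactSpace.mp hK
  have hcl : IsClosed {q : K × (ℕ → Ioo (0 : ℝ) 1) | ∀ p ∈ F, (q.1 : X) ∈ weakCell f q.2 p} := by
    simp only [ofPred_forall]
    refine isClosed_biInter fun p _ => ?_
    obtain ⟨n, o⟩ := p
    have h₁ : Continuous fun q : K × (ℕ → Ioo (0 : ℝ) 1) => f n q.1 := by fun_prop
    have h₂ : Continuous fun q : K × (ℕ → Ioo (0 : ℝ) 1) => (q.2 n : ℝ) := by fun_prop
    cases o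
    · exact isClosed_eq h₁ h₂
    · exact isClosed_le continuous_const (continuous_sideGap _ h₁ h₂)
  convert isClosedMap_snd_of_compactSpace _ hcl using 1
  ext c
  simp [feasibleThresholds]

/-- By the Baire category theorem, some threshold sequence avoids countably many frontiers of
closed sets. -/
theorem exists_thresholds_notMem_frontier {ι : Type*} [Countable ι]
    {A : ι → Set (ℕ → Ioo (0 : ℝ) 1)} (hA : ∀ i, IsClosed (A i)) :
    ∃ c, ∀ i, c ∉ frontier (A i) := by
  have : PolishSpace (Ioo (0 : ℝ) 1) := isOpen_Ioo.polishSpace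
  let _ := upgradeIsCompletelyMetrizable (ℕ → Ioo (0 : ℝ) 1)
  have hd : Dense (⋂ i, (frontier (A i))ᶜ) :=
    dense_iInter_of_isOpen (fun i => isClosed_frontier.isOpen_compl) fun i =>
      interior_eq_empty_iff_dense_compl.mp (interior_frontier (hA i))
  have : Nonempty (ℕ → Ioo (0 : ℝ) 1) := ⟨fun _ => ⟨1 / 2, by norm_num⟩⟩
  obtain ⟨c, hc⟩ := hd.nonempty
  exact ⟨c, fun i => mem_iInter.mp hc i⟩

theorem exists_shifted_threshold_mem {U : Set (ℕ → Ioo (0 : ℝ) 1)} {c : ℕ → Ioo (0 : ℝ) 1}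
    (hU : U ∈ 𝓝 c) (n : ℕ) (a : Bool) :
    ∃ t : Ioo (0 : ℝ) 1, 0 < sideGap a t (c n) ∧ Function.update c n t ∈ U := by
  have hcont : Continuous fun t => Function.update c n t := by fun_prop
  have hV : (fun t => Function.update c n t) ⁻¹' U ∈ 𝓝 (c n) :=
    hcont.continuousAt.preimage_mem_nhds (by simpa using hU)
  cases a
  · obtain ⟨t, htU, ht⟩ := (Filter.inter_mem (mem_nhdsWithin_of_mem_nhds hV)
      self_mem_nhdsWithin : _ ∈ 𝓝[<] (c n)) |> Filter.nonempty_of_mem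
    exact ⟨t, by simpa [sideGap] using ht, htU⟩
  · obtain ⟨t, htU, ht⟩ := (Filter.inter_mem (mem_nhdsWithin_of_mem_nhds hV)
      self_mem_nhdsWithin : _ ∈ 𝓝[>] (c n)) |> Filter.nonempty_of_mem
    exact ⟨t, by simpa [sideGap] using ht, htU⟩

/-- If a threshold sequence avoids the frontiers of the feasible sets, then every closed cell of
its family is the closure of the corresponding open cell. -/
theorem dyadicClosed3_eq_closure_of_notMem_frontier {X : Type*} [TopologicalSpace X]
    {f : ℕ → X → ℝ} (hf : ∀ n, Continuous (f n)) {𝒦 : Set (Set X)}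
    (h𝒦 : ∀ x : X, ∀ U, IsOpen U → x ∈ U → ∃ K ∈ 𝒦, x ∈ K ∧ K ⊆ U) {c : ℕ → Ioo (0 : ℝ) 1}
    (hc : ∀ K ∈ 𝒦, ∀ F, c ∉ frontier (feasibleThresholds f K F)) (dom : Finset ℕ)
    (σ : ℕ → Option Bool) :
    dyadicClosed3 (thresholdFamily f c) dom σ =
      closure (dyadicOpen3 (thresholdFamily f c) dom σ) := by
  classical
  refine Subset.antisymm ?_ (closure_minimal (dyadicOpen3_subset_dyadicClosed3 _ _ _)
    (isClosed_dyadicClosed3_thresholdFamily hf c dom σ))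
  suffices h : ∀ D E : Finset ℕ, (∀ n ∈ D, σ n = none) → (∀ n ∈ E, σ n ≠ none) →
      dyadicClosed3 (thresholdFamily f c) (E ∪ D) σ ⊆
        closure (dyadicOpen3 (thresholdFamily f c) (E ∪ D) σ) by
    have := h (dom.filter fun n => σ n = none) (dom.filter fun n => ¬ σ n = none)
      (by simp) (by simp)
    rwa [Finset.union_comm, Finset.filter_union_filter_not_eq] at this
  intro D E hD hE
  induction E using Finset.induction_on with
  | empty =>
    refine Subset.trans (iInter₂_mono fun n hn => ?_) subset_closure
    rw [hD n (by simpa using hn)]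
    exact Subset.rfl
  | insert k E hk ih =>
    specialize ih fun n hn => hE n (Finset.mem_insert_of_mem hn)
    obtain ⟨a, ha⟩ := Option.ne_none_iff_exists'.mp (hE k (Finset.mem_insert_self k E))
    have hkD : k ∉ E ∪ D := by
      rw [Finset.mem_union, not_or]
      exact ⟨hk, fun h => by simp [hD k h] at ha⟩
    rw [Finset.insert_union]
    intro x hx
    rw [mem_dyadicClosed3_thresholdFamily] at hx
    rw [mem_closure_iff]
    intro U hU hxU
    obtain ⟨K, hK, hxK, hKU⟩ := h𝒦 x U hU hxU
    set F := (insert k (E ∪ D)).image fun n => (n, σ n)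
    have hcF : c ∈ feasibleThresholds f K F :=
      ⟨x, hxK, Finset.forall_mem_image.mpr hx⟩
    have hint : feasibleThresholds f K F ∈ 𝓝 c := by
      rw [mem_nhds_iff]
      by_contra hcon
      refine hc K hK F ⟨subset_closure hcF, fun hi => hcon ?_⟩
      exact ⟨_, interior_subset, isOpen_interior, hi⟩
    obtain ⟨t, ht, y, hyK, hy⟩ := exists_shifted_threshold_mem hint k a
    have hyk : y ∈ thresholdFamily f c k a := by
      have := hy (k, σ k) (Finset.mem_image_of_mem _ (Finset.mem_insert_self _ _))
      simp only [weakCell, ha, Option.elim_some, Function.update_self, mem_ofPred_eq] at this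
      simp only [thresholdFamily, mem_ofPred_eq]
      cases a <;> simp only [sideGap, Bool.false_eq_true, if_false, if_true] at this ht ⊢ <;>
        linarith
    have hyG : y ∈ dyadicClosed3 (thresholdFamily f c) (E ∪ D) σ := by
      rw [mem_dyadicClosed3_thresholdFamily]
      intro n hn
      have := hy (n, σ n) (Finset.mem_image_of_mem _ (Finset.mem_insert_of_mem hn))
      have hnk : n ≠ k := fun h => hkD (h ▸ hn)
      simpa only [weakCell, Function.update_of_ne hnk] using this
    obtain ⟨z, ⟨hzU, hzk⟩, hz⟩ := mem_closure_iff.mp (ih hyG) _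
      (hU.inter (isOpen_thresholdFamily hf c k a)) ⟨hKU hyK, hyk⟩
    refine ⟨z, hzU, ?_⟩
    simp only [dyadicOpen3, Finset.mem_insert, iInter_iInter_eq_or_left, mem_inter_iff, ha]
    exact ⟨hzk, hz⟩

/-- Countably many continuous functions separate points from closed sets with the values
`1` and `0`. -/
theorem exists_seq_continuous_separating (X : Type*) [TopologicalSpace X]
    [SecondCountableTopology X] [RegularSpace X] :
    ∃ f : ℕ → X → ℝ, (∀ n, Continuous (f n)) ∧
      ∀ x : X, ∀ U, IsOpen U → x ∈ U → ∃ n, f n x = 1 ∧ ∀ y ∉ U, f n y = 0 := by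
  have : NormalSpace X := NormalSpace.of_regularSpace_secondCountableTopology
  let B := countableBasis X
  have key : ∀ p : B × B, ∃ g : X → ℝ, Continuous g ∧ (closure (p.1 : Set X) ⊆ p.2 →
      (∀ x ∈ (p.1 : Set X), g x = 1) ∧ ∀ y ∉ (p.2 : Set X), g y = 0) := by
    intro p
    by_cases h : closure (p.1 : Set X) ⊆ p.2
    · obtain ⟨g, hg0, hg1, -⟩ := exists_continuous_zero_one_of_isClosed
        (isOpen_of_mem_countableBasis p.2.2).isClosed_compl isClosed_closure
        (disjoint_compl_left_iff_subset.mpr h)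
      exact ⟨g, g.continuous, fun _ => ⟨fun x hx => hg1 (subset_closure hx), fun y hy => hg0 hy⟩⟩
    · exact ⟨fun _ => 0, continuous_const, fun h' => absurd h' h⟩
  choose g hg hsep using key
  have : Countable B := (countable_countableBasis X).to_subtype
  obtain ⟨e, he⟩ := exists_surjective_nat (Option (B × B))
  refine ⟨fun n => (e n).elim (fun _ => 0) g, fun n => ?_, fun x U hU hx => ?_⟩
  · cases h : e n
    · simpa only [h, Option.elim_none] using continuous_const
    · simpa only [h, Option.elim_some] using hg _
  · obtain ⟨V, hV, hxV, hVU⟩ := (isBasis_countableBasis X).exists_subset_of_mem_open hx hU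
    obtain ⟨W, hW, hxW, hWV⟩ := (isBasis_countableBasis X).exists_closure_subset
      ((isOpen_of_mem_countableBasis hV).mem_nhds hxV)
    obtain ⟨n, hn⟩ := he (some (⟨W, hW⟩, ⟨V, hV⟩))
    have := hsep (⟨W, hW⟩, ⟨V, hV⟩) hWV
    refine ⟨n, ?_, fun y hy => ?_⟩
    · simpa [hn] using this.1 x hxW
    · simpa [hn] using this.2 y fun h => hy (hVU h)

/-- A second countable locally compact regular space has a countable network of compact sets. -/
theorem exists_countable_compact_network (X : Type*) [TopologicalSpace X]
    [SecondCountableTopology X] [LocallyCompactSpace X] [RegularSpace X] :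
    ∃ 𝒦 : Set (Set X), 𝒦.Countable ∧ (∀ K ∈ 𝒦, IsCompact K) ∧
      ∀ x : X, ∀ U, IsOpen U → x ∈ U → ∃ K ∈ 𝒦, x ∈ K ∧ K ⊆ U := by
  refine ⟨{K ∈ closure '' countableBasis X | IsCompact K},
    ((countable_countableBasis X).image _).mono (sep_subset _ _), fun K hK => hK.2,
    fun x U hU hx => ?_⟩
  obtain ⟨L, hL, hLU, hLc⟩ := local_compact_nhds (hU.mem_nhds hx)
  obtain ⟨W, hW, hxW, hWL⟩ := (isBasis_countableBasis X).exists_closure_subset hL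
  exact ⟨closure W, ⟨mem_image_of_mem _ hW, hLc.closure_of_subset (subset_closure.trans hWL)⟩,
    subset_closure hxW, hWL.trans hLU⟩

end

/-- Every locally compact separable metric space has a strongly proper dyadic subbase. -/
theorem exists_stronglyProper_dyadicSubbase (X : Type*) [MetricSpace X]
    [SeparableSpace X] [LocallyCompactSpace X] :
    ∃ S : ℕ → Bool → Set X,
      (∀ n a, IsOpen (S n a)) ∧
      (∀ n, S n false ∩ S n true = ∅) ∧
      ((inferInstance : TopologicalSpace X) =
        TopologicalSpace.generateFrom {U : Set X | ∃ n a, U = S n a}) ∧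
      (∀ (dom : Finset ℕ) (σ : ℕ → Option Bool),
        dyadicClosed3 S dom σ = closure (dyadicOpen3 S dom σ)) := by
  have : SecondCountableTopology X := UniformSpace.secondCountable_of_separable X
  obtain ⟨f, hf, hsep⟩ := exists_seq_continuous_separating X
  obtain ⟨𝒦, h𝒦c, h𝒦, hnet⟩ := exists_countable_compact_network X
  have := h𝒦c.to_subtype
  obtain ⟨c, hc⟩ := exists_thresholds_notMem_frontier
    (A := fun i : 𝒦 × Finset (ℕ × Option Bool) => feasibleThresholds f i.1 i.2)
    fun i => isClosed_feasibleThresholds hf (h𝒦 _ i.1.2) i.2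
  refine ⟨thresholdFamily f c, isOpen_thresholdFamily hf c, fun n => ?_, ?_,
    dyadicClosed3_eq_closure_of_notMem_frontier hf hnet fun K hK F => hc (⟨K, hK⟩, F)⟩
  · ext x
    simpa [thresholdFamily, sideGap] using le_of_lt
  · refine (isTopologicalBasis_of_isOpen_of_nhds ?_ fun x U hx hU => ?_).eq_generateFrom
    · rintro _ ⟨n, a, rfl⟩
      exact isOpen_thresholdFamily hf c n a
    · obtain ⟨n, hn1, hn0⟩ := hsep x U hU hx
      refine ⟨thresholdFamily f c n true, ⟨n, true, rfl⟩, ?_, fun y hy => ?_⟩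
      · simp only [thresholdFamily, sideGap, if_true, Set.mem_ofPred_eq, hn1]
        linarith [(c n).2.2]
      · by_contra hyU
        simp only [thresholdFamily, sideGap, if_true, Set.mem_ofPred_eq, hn0 y hyU] at hy
        linarith [(c n).2.1]
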